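/- For every λ > 1, the set of positive real numbers t with J₁((λ−1)^{1/2}t) ≠ 0 satisfying t(K₁′(t)/K₁(t) + (λ−1)^{−1/2} J₁′((λ−1)^{1/2}t)/J₁((λ−1)^{1/2}t)) = λ/(λ−1) is nonempty and possesses a smallest element a = a(λ) > 0. -/

import Mathlib

open MeasureTheory Real Filter

noncomputable section

/-- The upper half plane `Π = {x ∈ ℝ² : x₂ > 0}`. -/
def UHP : Set (ℝ × ℝ) := {x | 0 < x.2}

/-- Euclidean norm of a point of `ℝ²`. -/
def rad (x : ℝ × ℝ) : ℝ := Real.sqrt (x.1 ^ 2 + x.2 ^ 2)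

/-- Modified Bessel function of the second kind of order `0`:
`K₀(r) = ∫₀^∞ exp(-r cosh t) dt`. -/
def K0 (r : ℝ) : ℝ := ∫ t in Set.Ioi (0 : ℝ), Real.exp (-(r * Real.cosh t))

/-- Fundamental solution `G(x,y) = (1/2π) K₀(|x-y|)` of `−Δ + Id` on `ℝ²`. -/
def Gker (x y : ℝ × ℝ) : ℝ := (1 / (2 * Real.pi)) * K0 (rad (x - y))

/-- Reflection `x̄ = (x₁, −x₂)` across the `x₁`-axis. -/
def reflPt (x : ℝ × ℝ) : ℝ × ℝ := (x.1, -x.2)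

/-- Green's function `G_Π(x,y) = G(x,y) − G(x̄,y)` of `−Δ + Id` on the half plane. -/
def GUHP (x y : ℝ × ℝ) : ℝ := Gker x y - Gker (reflPt x) y

/-- The operator `𝒢ω(x) = ∫_Π G_Π(x,y) ω(y) dy`. -/
def Gop (ω : ℝ × ℝ → ℝ) (x : ℝ × ℝ) : ℝ := ∫ y in UHP, GUHP x y * ω y

/-- Kinetic energy `E(ω) = (1/2) ∫_Π ω 𝒢ω`. -/
def kineticE (ω : ℝ × ℝ → ℝ) : ℝ := (1 / 2) * ∫ x in UHP, ω x * Gop ω x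

/-- Impulse `I(ω) = ∫_Π x₂ ω dx`. -/
def impulse (ω : ℝ × ℝ → ℝ) : ℝ := ∫ x in UHP, x.2 * ω x

/-- `L¹(Π)` norm. -/
def normL1 (f : ℝ × ℝ → ℝ) : ℝ := ∫ x in UHP, |f x|

/-- `L²(Π)` norm. -/
def normL2 (f : ℝ × ℝ → ℝ) : ℝ := (∫ x in UHP, (f x) ^ 2) ^ ((1 : ℝ) / 2)

/-- `L^s(Π)` norm. -/
def normLs (s : ℝ) (f : ℝ × ℝ → ℝ) : ℝ := (∫ x in UHP, |f x| ^ s) ^ (1 / s)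

/-- Nonnegative member of `L¹(Π) ∩ L²(Π)`. -/
def NonnegL1L2 (ω : ℝ × ℝ → ℝ) : Prop :=
  (∀ x ∈ UHP, 0 ≤ ω x) ∧ IntegrableOn ω UHP ∧ IntegrableOn (fun x => (ω x) ^ 2) UHP

/-- Steiner symmetry in the `x₁` variable. -/
def SteinerSym (f : ℝ × ℝ → ℝ) : Prop :=
  (∀ x : ℝ × ℝ, f (-x.1, x.2) = f x) ∧
  ∀ x₂ : ℝ, 0 < x₂ → AntitoneOn (fun x₁ => f (x₁, x₂)) (Set.Ioi (0 : ℝ))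

/-- The admissible class `𝒜_{μ,ν}`. -/
def InAdm (μ ν : ℝ) (ω : ℝ × ℝ → ℝ) : Prop :=
  (∀ x ∈ UHP, 0 ≤ ω x) ∧ IntegrableOn ω UHP ∧ IntegrableOn (fun x => (ω x) ^ 2) UHP ∧
  IntegrableOn (fun x => x.2 * ω x) UHP ∧
  impulse ω = μ ∧ (∫ x in UHP, ω x) ≤ ν

/-- The energy functional `ℰ_λ(ω) = E(ω) − (1/(2λ)) ∫_Π ω²`. -/
def Efun (lam : ℝ) (ω : ℝ × ℝ → ℝ) : ℝ :=
  kineticE ω - (1 / (2 * lam)) * ∫ x in UHP, (ω x) ^ 2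

/-- The supremum `S_{μ,ν,λ} = sup_{ω ∈ 𝒜_{μ,ν}} ℰ_λ(ω)`. -/
def Sval (lam μ ν : ℝ) : ℝ := sSup {s | ∃ ω, InAdm μ ν ω ∧ s = Efun lam ω}

/-- `ω` is a maximizer, i.e. `ω ∈ Σ_{μ,ν,λ}`. -/
def IsMaximizer (lam μ ν : ℝ) (ω : ℝ × ℝ → ℝ) : Prop :=
  InAdm μ ν ω ∧ Efun lam ω = Sval lam μ ν

/-- Bessel function of the first kind of order one. -/
def J1 (r : ℝ) : ℝ :=
  ∑' k : ℕ, ((-1 : ℝ) ^ k / ((Nat.factorial k : ℝ) * (Nat.factorial (k + 1) : ℝ))) *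
    (r / 2) ^ (2 * k + 1)

/-- Modified Bessel function of the second kind of order one. -/
def K1 (r : ℝ) : ℝ := ∫ t in Set.Ioi (0 : ℝ), Real.exp (-(r * Real.cosh t)) * Real.cosh t

/-- The set of `t > 0` with `J₁(√(λ−1) t) ≠ 0` solving the transcendental equation
`t (K₁'(t)/K₁(t) + (λ−1)^{-1/2} J₁'(√(λ−1)t)/J₁(√(λ−1)t)) = λ/(λ−1)`. -/
def aSet (lam : ℝ) : Set ℝ :=
  {t | 0 < t ∧ J1 (Real.sqrt (lam - 1) * t) ≠ 0 ∧
    t * (deriv K1 t / K1 t +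
      (1 / Real.sqrt (lam - 1)) *
        (deriv J1 (Real.sqrt (lam - 1) * t) / J1 (Real.sqrt (lam - 1) * t))) = lam / (lam - 1)}

/-- The smallest positive solution `a = a(λ)`. -/
def aLam (lam : ℝ) : ℝ := sInf (aSet lam)

/-- The stream function `Ψ_L^{λ,W}` of the Lamb dipole, written in polar coordinates
`x₁ = r cos θ`, `x₂ = r sin θ` (so that `sin θ = x₂ / r`). -/
def PsiL (lam W : ℝ) (x : ℝ × ℝ) : ℝ :=
  if rad x ≤ aLam lam then
    ((-(W * aLam lam / (lam - 1)) / J1 (Real.sqrt (lam - 1) * aLam lam)) *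
        J1 (Real.sqrt (lam - 1) * rad x) + (W * lam / (lam - 1)) * rad x) * (x.2 / rad x)
  else (W * aLam lam / K1 (aLam lam)) * K1 (rad x) * (x.2 / rad x)

/-- The Lamb dipole `ω_L^{λ,W} = λ (Ψ_L^{λ,W} − W x₂)₊` restricted to `Π`. -/
def omegaL (lam W : ℝ) (x : ℝ × ℝ) : ℝ :=
  if 0 < x.2 then lam * max (PsiL lam W x - W * x.2) 0 else 0

/-- `ϱ(λ) = (∫_Π ω_L^{λ,1} dx) / I(ω_L^{λ,1})`. -/
def varrho (lam : ℝ) : ℝ := (∫ x in UHP, omegaL lam 1 x) / impulse (omegaL lam 1)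

/-- The Laplacian on `ℝ²`, written coordinatewise. -/
def lap (ψ : ℝ × ℝ → ℝ) (x : ℝ × ℝ) : ℝ :=
  deriv (deriv fun t => ψ (t, x.2)) x.1 + deriv (deriv fun t => ψ (x.1, t)) x.2

/-- Distance (in `L¹ ∩ L²` plus weighted `L¹`) from `ζ` to a set of functions `S`. -/
def distToSet (S : Set ((ℝ × ℝ) → ℝ)) (ζ : (ℝ × ℝ) → ℝ) : ℝ :=
  sInf {d | ∃ ω ∈ S, d = normL1 (fun x => ζ x - ω x) + normL2 (fun x => ζ x - ω x) +
    normL1 (fun x => x.2 * (ζ x - ω x))}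

end


noncomputable section

/-- Power series with coefficients `c`. -/
def PS (c : ℕ → ℝ) (y : ℝ) : ℝ := ∑' k : ℕ, c k * y ^ k

/-- Coefficients of the derivative. -/
def dcf (c : ℕ → ℝ) (k : ℕ) : ℝ := (k + 1) * c (k + 1)

/-- Coefficients of `J₁`. -/
def cJ (k : ℕ) : ℝ := (-1 : ℝ) ^ k / ((Nat.factorial k : ℝ) * (Nat.factorial (k + 1) : ℝ))

def Bdd (c : ℕ → ℝ) : Prop := ∀ k, |c k| ≤ 1 / (Nat.factorial k : ℝ)

end

lemma Bdd.dcB {c : ℕ → ℝ} (hc : Bdd c) : Bdd (dcf c) := by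
  intro k
  have h := hc (k + 1)
  have hk : (0 : ℝ) < k + 1 := by positivity
  have hf : (0 : ℝ) < (Nat.factorial k : ℝ) := by positivity
  change |((k : ℝ) + 1) * c (k + 1)| ≤ _
  rw [abs_mul, abs_of_pos hk]
  calc ((k : ℝ) + 1) * |c (k + 1)| ≤ (k + 1) * (1 / (Nat.factorial (k + 1) : ℝ)) := by gcongr
    _ = 1 / (Nat.factorial k : ℝ) := by
      rw [Nat.factorial_succ]; push_cast; field_simp

lemma bdd_cJ : Bdd cJ := by
  intro k
  rw [cJ, abs_div, abs_pow, abs_neg, abs_one, one_pow, abs_of_pos (by positivity)]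
  apply one_div_le_one_div_of_le (by positivity)
  have : (1 : ℝ) ≤ (Nat.factorial (k + 1) : ℝ) := by exact_mod_cast Nat.factorial_pos _
  have hf : (0 : ℝ) < (Nat.factorial k : ℝ) := by positivity
  nlinarith

lemma Bdd.term {c : ℕ → ℝ} (hc : Bdd c) (y : ℝ) (k : ℕ) :
    ‖c k * y ^ k‖ ≤ |y| ^ k / (Nat.factorial k : ℝ) := by
  rw [Real.norm_eq_abs, abs_mul, abs_pow]
  calc |c k| * |y| ^ k ≤ 1 / (Nat.factorial k : ℝ) * |y| ^ k := by gcongr; exact hc k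
    _ = _ := by ring

lemma Bdd.summable {c : ℕ → ℝ} (hc : Bdd c) (y : ℝ) : Summable fun k => c k * y ^ k :=
  Summable.of_norm_bounded (g := fun k => |y| ^ k / (Nat.factorial k : ℝ))
    (Real.summable_pow_div_factorial |y|) (hc.term y)

lemma PS_zero (c : ℕ → ℝ) : PS c 0 = c 0 := by
  rw [PS, tsum_eq_single 0]
  · simp
  · intro k hk; rw [zero_pow hk, mul_zero]

lemma Bdd.shift {c : ℕ → ℝ} (hc : Bdd c) (y : ℝ) :
    PS c y = c 0 + ∑' k, c (k + 1) * y ^ (k + 1) := by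
  rw [PS, (hc.summable y).tsum_eq_zero_add]; simp

lemma Bdd.hasDerivAt {c : ℕ → ℝ} (hc : Bdd c) (y : ℝ) :
    HasDerivAt (PS c) (PS (dcf c) y) y := by
  have h : HasDerivAt (fun z : ℝ => ∑' k, c (k + 1) * z ^ (k + 1)) (∑' k, dcf c k * y ^ k) y := by
    refine hasDerivAt_tsum_of_isPreconnected
      (u := fun k => (|y| + 1) ^ k / (Nat.factorial k : ℝ))
      (t := Metric.ball (0 : ℝ) (|y| + 1)) (y₀ := y)
      (g := fun k z => c (k + 1) * z ^ (k + 1)) (g' := fun k z => dcf c k * z ^ k)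
      (Real.summable_pow_div_factorial _) (Metric.isOpen_ball)
      (convex_ball (0 : ℝ) (|y| + 1)).isPreconnected ?_ ?_ ?_ ?_ ?_
    · intro k z _
      have := (hasDerivAt_pow (k + 1) z).const_mul (c (k + 1))
      refine this.congr_deriv ?_
      simp only [dcf, Nat.add_sub_cancel]; push_cast; ring
    · intro k z hz
      refine (hc.dcB.term z k).trans ?_
      have : |z| ≤ |y| + 1 := by
        rw [Metric.mem_ball, dist_zero_right, Real.norm_eq_abs] at hz; exact hz.le
      gcongr
    · simp
    · exact (summable_nat_add_iff 1).2 (hc.summable y)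
    · simp
  have h2 := h.const_add (c 0)
  have : PS c = fun z => c 0 + ∑' k, c (k + 1) * z ^ (k + 1) := by
    funext z; exact hc.shift z
  rw [this]; exact h2

lemma Bdd.approx {c : ℕ → ℝ} (hc : Bdd c) :
    |PS c 9 - ∑ k ∈ Finset.range 30, c k * 9 ^ k| ≤ 1 / 1000 := by
  have h := (hc.summable 9).sum_add_tsum_nat_add 30
  rw [PS, ← h, add_sub_cancel_left]
  have hg : HasSum (fun k : ℕ => (9 : ℝ) ^ 30 / (Nat.factorial 30 : ℝ) * (1 / 2) ^ k)
      ((9 : ℝ) ^ 30 / (Nat.factorial 30 : ℝ) * 2) := hasSum_geometric_two.mul_left _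
  rw [← Real.norm_eq_abs]
  refine (tsum_of_norm_bounded (f := fun k : ℕ => c (k + 30) * (9 : ℝ) ^ (k + 30)) hg ?_).trans ?_
  · intro k
    refine (hc.term 9 (k + 30)).trans ?_
    have h1 : ((Nat.factorial 30 : ℝ)) * 31 ^ k ≤ (Nat.factorial (k + 30) : ℝ) := by
      rw [add_comm k 30]
      exact_mod_cast Nat.factorial_mul_pow_le_factorial (m := 30) (n := k)
    have h2 : (0 : ℝ) < (Nat.factorial 30 : ℝ) := by positivity
    rw [abs_of_pos (by norm_num : (0 : ℝ) < 9)]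
    calc (9 : ℝ) ^ (k + 30) / (Nat.factorial (k + 30) : ℝ)
        ≤ 9 ^ (k + 30) / ((Nat.factorial 30 : ℝ) * 31 ^ k) := by gcongr
      _ = 9 ^ 30 / (Nat.factorial 30 : ℝ) * (9 / 31) ^ k := by
        rw [div_pow, pow_add]; field_simp
      _ ≤ _ := by
        refine mul_le_mul_of_nonneg_left ?_ (by positivity)
        exact pow_le_pow_left₀ (by norm_num) (by norm_num) k
  · norm_num [Nat.factorial]

lemma cJ_ode (y : ℝ) :
    y * PS (dcf (dcf cJ)) y + 2 * PS (dcf cJ) y + PS cJ y = 0 := by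
  have s0 := bdd_cJ.summable y
  have s1 := bdd_cJ.dcB.summable y
  have s2 := bdd_cJ.dcB.dcB.summable y
  have e2 : y * PS (dcf (dcf cJ)) y = ∑' k : ℕ, (k : ℝ) * dcf cJ k * y ^ k := by
    have hs : Summable fun k : ℕ => (k : ℝ) * dcf cJ k * y ^ k := by
      rw [← summable_nat_add_iff 1]
      refine (s2.mul_left y).congr fun k => ?_
      rw [dcf]; push_cast; ring
    rw [hs.tsum_eq_zero_add, PS, ← tsum_mul_left]
    simp only [Nat.cast_zero, zero_mul, zero_add]
    refine tsum_congr fun k => ?_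
    rw [dcf]; push_cast; ring
  have hs : Summable fun k : ℕ => (k : ℝ) * dcf cJ k * y ^ k := by
    rw [← summable_nat_add_iff 1]
    refine (s2.mul_left y).congr fun k => ?_
    rw [dcf]; push_cast; ring
  rw [e2, PS, PS, ← tsum_mul_left, ← hs.tsum_add (s1.mul_left 2),
    ← (hs.add (s1.mul_left 2)).tsum_add s0]
  rw [← tsum_zero (α := ℝ) (β := ℕ)]
  refine tsum_congr fun k => ?_
  rw [dcf, cJ, cJ, Nat.factorial_succ (k + 1), Nat.factorial_succ k, pow_succ (-1 : ℝ) k]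
  have hf : (Nat.factorial k : ℝ) ≠ 0 := by positivity
  have h1 : (k : ℝ) + 1 ≠ 0 := by positivity
  have h2 : (k : ℝ) + 1 + 1 ≠ 0 := by positivity
  push_cast
  field_simp
  ring

lemma J1_eq (x : ℝ) : J1 x = x / 2 * PS cJ (x ^ 2 / 4) := by
  rw [J1, PS, ← tsum_mul_left]
  refine tsum_congr fun k => ?_
  rw [cJ, pow_add, pow_mul, show (x / 2) ^ 2 = x ^ 2 / 4 by ring]; ring

lemma hasDerivAt_comp {c : ℕ → ℝ} (hc : Bdd c) (x : ℝ) :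
    HasDerivAt (fun x => PS c (x ^ 2 / 4)) (PS (dcf c) (x ^ 2 / 4) * (x / 2)) x := by
  have h : HasDerivAt (fun x : ℝ => x ^ 2 / 4) (x / 2) x := by
    refine ((hasDerivAt_pow 2 x).div_const 4).congr_deriv ?_
    push_cast; ring
  exact (hc.hasDerivAt _).comp x h

lemma J1_hasDerivAt (x : ℝ) :
    HasDerivAt J1 (PS cJ (x ^ 2 / 4) / 2 + x ^ 2 / 4 * PS (dcf cJ) (x ^ 2 / 4)) x := by
  have : J1 = fun x => x / 2 * PS cJ (x ^ 2 / 4) := funext J1_eq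
  rw [this]
  refine (((hasDerivAt_id x).div_const 2).mul (hasDerivAt_comp bdd_cJ x)).congr_deriv ?_
  simp only [id]; ring

lemma J1_deriv (x : ℝ) :
    deriv J1 x = PS cJ (x ^ 2 / 4) / 2 + x ^ 2 / 4 * PS (dcf cJ) (x ^ 2 / 4) :=
  (J1_hasDerivAt x).deriv

lemma hasDerivAt_xJ1 (x : ℝ) :
    HasDerivAt (fun x => x * deriv J1 x) (PS cJ (x ^ 2 / 4) / 2 * (1 - x ^ 2)) x := by
  have : (fun x => x * deriv J1 x) = fun x =>
      x * (PS cJ (x ^ 2 / 4) / 2 + x ^ 2 / 4 * PS (dcf cJ) (x ^ 2 / 4)) := by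
    funext x; rw [J1_deriv]
  rw [this]
  have h : HasDerivAt (fun x : ℝ => x ^ 2 / 4) (x / 2) x := by
    refine ((hasDerivAt_pow 2 x).div_const 4).congr_deriv ?_
    push_cast; ring
  have h2 := (hasDerivAt_id x).mul (((hasDerivAt_comp bdd_cJ x).div_const 2).add
    (h.mul (hasDerivAt_comp bdd_cJ.dcB x)))
  refine h2.congr_deriv ?_
  have ode := cJ_ode (x ^ 2 / 4)
  simp only [id, Pi.add_apply, Pi.mul_apply]
  linear_combination (x ^ 2 / 2) * ode

lemma cont_PS {c : ℕ → ℝ} (hc : Bdd c) : Continuous (PS c) :=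
  continuous_iff_continuousAt.2 fun y => (hc.hasDerivAt y).continuousAt

lemma cont_J1 : Continuous J1 :=
  continuous_iff_continuousAt.2 fun y => (J1_hasDerivAt y).continuousAt

lemma cont_dJ1 : Continuous (deriv J1) := by
  have : deriv J1 = fun x => PS cJ (x ^ 2 / 4) / 2 + x ^ 2 / 4 * PS (dcf cJ) (x ^ 2 / 4) :=
    funext J1_deriv
  rw [this]
  have h0 := cont_PS bdd_cJ
  have h1 := cont_PS bdd_cJ.dcB
  fun_prop

lemma cJ_zero : cJ 0 = 1 := by simp [cJ]

/-- `PS cJ (x²/4)` is positive near `0`. -/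
lemma near_pos : ∀ᶠ x in nhds (0 : ℝ), 0 < PS cJ (x ^ 2 / 4) := by
  have h0 := cont_PS bdd_cJ
  have hc : Continuous fun x : ℝ => PS cJ (x ^ 2 / 4) := by fun_prop
  refine hc.continuousAt.eventually (lt_mem_nhds ?_)
  norm_num [PS_zero, cJ_zero]

lemma near_neg {lam : ℝ} (hlam : 1 < lam) :
    ∀ᶠ x in nhds (0 : ℝ),
      (1 - lam) * PS cJ (x ^ 2 / 4) + 2 * (x ^ 2 / 4) * PS (dcf cJ) (x ^ 2 / 4) < 0 := by
  have h0 := cont_PS bdd_cJ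
  have h1 := cont_PS bdd_cJ.dcB
  have hc : Continuous fun x : ℝ =>
    (1 - lam) * PS cJ (x ^ 2 / 4) + 2 * (x ^ 2 / 4) * PS (dcf cJ) (x ^ 2 / 4) := by fun_prop
  refine hc.continuousAt.eventually (gt_mem_nhds ?_)
  norm_num [PS_zero, cJ_zero]
  exact hlam

lemma simple_zero {x₀ : ℝ} (hx : 0 < x₀) (h0 : J1 x₀ = 0) : deriv J1 x₀ ≠ 0 := by
  intro h1
  set E : ℝ → ℝ := fun x => (x * deriv J1 x) ^ 2 + (x ^ 2 - 1) * (J1 x) ^ 2 with hE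
  have hd : ∀ x, HasDerivAt E (2 * x * J1 x ^ 2) x := by
    intro x
    have a := (hasDerivAt_xJ1 x).pow 2
    have b := ((hasDerivAt_pow 2 x).sub_const 1).mul ((J1_hasDerivAt x).pow 2)
    refine (a.add b).congr_deriv ?_
    simp only [Pi.pow_apply]
    rw [← J1_deriv, J1_eq x]
    push_cast
    ring
  have hmono : MonotoneOn E (Set.Ici 0) := by
    refine monotoneOn_of_deriv_nonneg (convex_Ici 0)
      (fun x _ => (hd x).continuousAt.continuousWithinAt)
      (fun x _ => (hd x).differentiableAt.differentiableWithinAt) ?_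
    intro x hx'
    rw [interior_Ici] at hx'
    have : 0 < x := hx'
    rw [(hd x).deriv]; positivity
  have E0 : E 0 = 0 := by simp [hE, J1_eq]
  have E1 : E x₀ = 0 := by simp [hE, h0, h1]
  have hz : ∀ x ∈ Set.Ioo 0 x₀, E x = 0 := by
    intro x hx'
    have l := hmono (Set.mem_Ici.2 le_rfl) (Set.mem_Ici.2 hx'.1.le) hx'.1.le
    have u := hmono (Set.mem_Ici.2 hx'.1.le) (Set.mem_Ici.2 hx.le) hx'.2.le
    linarith
  have hJ : ∀ x ∈ Set.Ioo 0 x₀, J1 x = 0 := by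
    intro x hx'
    have he : E =ᶠ[nhds x] fun _ => 0 := by
      filter_upwards [isOpen_Ioo.mem_nhds hx'] with z hz' using hz z hz'
    have := (hd x).unique ((hasDerivAt_const x (0 : ℝ)).congr_of_eventuallyEq he)
    have hx0 : x ≠ 0 := hx'.1.ne'
    simpa [hx0] using this
  obtain ⟨δ, hδ, hball⟩ := Metric.eventually_nhds_iff.1 near_pos
  set x := min (δ / 2) (x₀ / 2) with hxdef
  have hxp : 0 < x := by positivity
  have hx1 : x < δ := (min_le_left _ _).trans_lt (by linarith)
  have hx2 : x < x₀ := (min_le_right _ _).trans_lt (by linarith)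
  have hp : 0 < PS cJ (x ^ 2 / 4) := hball (by rw [Real.dist_eq, sub_zero, abs_of_pos hxp]; exact hx1)
  have hJ0 := hJ x ⟨hxp, hx2⟩
  rw [J1_eq] at hJ0
  have : 0 < x / 2 * PS cJ (x ^ 2 / 4) := by positivity
  linarith

lemma J1_six : J1 6 < 0 ∧ 0 < deriv J1 6 := by
  have a := abs_le.1 bdd_cJ.approx
  have b := abs_le.1 bdd_cJ.dcB.approx
  have a' : ∑ k ∈ Finset.range 30, cJ k * 9 ^ k < -9 / 100 := by
    norm_num [Finset.sum_range_succ, cJ, Nat.factorial]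
  have a'' : -10 / 100 < ∑ k ∈ Finset.range 30, cJ k * 9 ^ k := by
    norm_num [Finset.sum_range_succ, cJ, Nat.factorial]
  have b' : 2 / 100 < ∑ k ∈ Finset.range 30, dcf cJ k * 9 ^ k := by
    norm_num [Finset.sum_range_succ, dcf, cJ, Nat.factorial]
  rw [J1_deriv, J1_eq]
  norm_num
  constructor <;> linarith

/-! ### The function `K₁` -/

lemma K_integrable {r : ℝ} (hr : 0 < r) :
    Integrable (fun t => Real.exp (r * (-Real.cosh t))) (volume.restrict (Set.Ioi 0)) := by
  have h : IntegrableOn (fun t => Real.exp ((-(r / 2)) * t)) (Set.Ioi 0) :=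
    integrableOn_exp_mul_Ioi (by linarith) 0
  refine Integrable.mono' h (by fun_prop) ?_
  refine Eventually.of_forall fun t => ?_
  rw [Real.norm_eq_abs, abs_of_pos (Real.exp_pos _)]
  apply Real.exp_le_exp.2
  have h1 := Real.add_one_le_exp t
  have h2 := Real.exp_pos (-t)
  have h3 : t / 2 ≤ Real.cosh t := by rw [Real.cosh_eq]; linarith
  nlinarith

lemma K_mem {r : ℝ} (hr : 0 < r) :
    r ∈ interior (ProbabilityTheory.integrableExpSet (fun t => -Real.cosh t)
      (volume.restrict (Set.Ioi 0))) := by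
  rw [mem_interior]
  exact ⟨Set.Ioi 0, fun s hs => K_integrable hs, isOpen_Ioi, hr⟩

lemma K1_eq (r : ℝ) : K1 r =
    -∫ t in Set.Ioi (0 : ℝ), (-Real.cosh t) ^ 1 * Real.exp (r * (-Real.cosh t)) := by
  rw [K1, ← integral_neg]
  congr 1; funext t
  rw [mul_neg]; ring

lemma K1_hasDerivAt {r : ℝ} (hr : 0 < r) :
    HasDerivAt K1
      (-∫ t in Set.Ioi (0 : ℝ), (-Real.cosh t) ^ 2 * Real.exp (r * (-Real.cosh t))) r := by
  rw [funext K1_eq]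
  exact (ProbabilityTheory.hasDerivAt_integral_pow_mul_exp_real (K_mem hr) 1).neg

lemma dK1_nonpos {r : ℝ} (hr : 0 < r) : deriv K1 r ≤ 0 := by
  rw [(K1_hasDerivAt hr).deriv, neg_nonpos]
  exact integral_nonneg fun t => by positivity

lemma dK1_cont : ContinuousOn (deriv K1) (Set.Ioi 0) := by
  have : ContinuousOn (fun r => -∫ t in Set.Ioi (0 : ℝ),
      (-Real.cosh t) ^ 2 * Real.exp (r * (-Real.cosh t))) (Set.Ioi 0) := fun r hr =>
    (ProbabilityTheory.hasDerivAt_integral_pow_mul_exp_real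
      (K_mem hr) 2).neg.continuousAt.continuousWithinAt
  exact this.congr fun r hr => (K1_hasDerivAt hr).deriv

lemma K1_cont : ContinuousOn K1 (Set.Ioi 0) := fun _ hr =>
  (K1_hasDerivAt hr).continuousAt.continuousWithinAt

lemma K1_pos {r : ℝ} (hr : 0 < r) : 0 < K1 r := by
  have hi : Integrable (fun t => Real.exp (-(r * Real.cosh t)) * Real.cosh t)
      (volume.restrict (Set.Ioi 0)) := by
    have := (ProbabilityTheory.integrable_pow_mul_exp_of_mem_interior_integrableExpSet
      (K_mem hr) 1).neg
    refine this.congr (Eventually.of_forall fun t => ?_)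
    simp only [Pi.neg_apply, mul_neg]; ring
  rw [K1, setIntegral_pos_iff_support_of_nonneg_ae _ hi]
  · have : Function.support (fun t => Real.exp (-(r * Real.cosh t)) * Real.cosh t) = Set.univ := by
      ext t
      simp [(Real.cosh_pos t).ne']
    rw [this, Set.univ_inter]; simp
  · exact Eventually.of_forall fun t => by
      have := Real.cosh_pos t
      simp only [Pi.zero_apply]; positivity

/-- the transcendental equation defining `a(λ)` has a smallest positive
solution. -/
theorem stmt13 (lam : ℝ) (hlam : 1 < lam) :
    ∃ a ∈ aSet lam, 0 < a ∧ ∀ t ∈ aSet lam, a ≤ t := by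
  set s := Real.sqrt (lam - 1) with hs
  have hs0 : 0 < s := Real.sqrt_pos.2 (by linarith)
  have hs2 : s ^ 2 = lam - 1 := Real.sq_sqrt (by linarith)
  set F : ℝ → ℝ := fun t => (lam - 1) * J1 (s * t) * (t * deriv K1 t) - lam * K1 t * J1 (s * t)
    + K1 t * (s * t * deriv J1 (s * t)) with hF
  have hmem : ∀ t, t ∈ aSet lam ↔ 0 < t ∧ F t = 0 := by
    intro t
    have key : ∀ t, 0 < t → J1 (s * t) ≠ 0 → (t * (deriv K1 t / K1 t +
      (1 / s) * (deriv J1 (s * t) / J1 (s * t))) = lam / (lam - 1) ↔ F t = 0) := by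
      intro t ht hJ
      have hK := (K1_pos ht).ne'
      have hl : s ^ 2 ≠ 0 := by positivity
      have hs' := hs0.ne'
      simp only [hF, ← hs2]
      have : t * (deriv K1 t / K1 t + (1 / s) * (deriv J1 (s * t) / J1 (s * t))) - lam / s ^ 2 =
        (s ^ 2 * J1 (s * t) * (t * deriv K1 t) - lam * K1 t * J1 (s * t)
    + K1 t * (s * t * deriv J1 (s * t))) / (s ^ 2 * K1 t * J1 (s * t)) := by
        generalize J1 (s * t) = j at *
        generalize deriv J1 (s * t) = j' at *
        field_simp
        ring
      rw [← sub_eq_zero, this, div_eq_zero_iff]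
      have : s ^ 2 * K1 t * J1 (s * t) ≠ 0 := by positivity
      simp [this]
    simp only [aSet, Set.mem_ofPred_eq, ← hs]
    constructor
    · rintro ⟨ht, hJ, he⟩
      exact ⟨ht, (key t ht hJ).1 he⟩
    · rintro ⟨ht, he⟩
      have hJ : J1 (s * t) ≠ 0 := by
        intro h0
        have h1 := simple_zero (mul_pos hs0 ht) h0
        have hK := (K1_pos ht).ne'
        simp [hF, h0, h1, hK, hs0.ne', ht.ne'] at he
      exact ⟨ht, hJ, (key t ht hJ).2 he⟩
  have hcont : ContinuousOn F (Set.Ioi 0) := by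
    have c1 := K1_cont
    have c2 := dK1_cont
    have c3 : Continuous fun t => J1 (s * t) := cont_J1.comp (by fun_prop)
    have c4 : Continuous fun t => deriv J1 (s * t) := cont_dJ1.comp (by fun_prop)
    have c3' := c3.continuousOn (s := Set.Ioi 0)
    have c4' := c4.continuousOn (s := Set.Ioi 0)
    fun_prop
  -- near zero
  obtain ⟨δ, hδ, hball⟩ := Metric.eventually_nhds_iff.1 (near_pos.and (near_neg hlam))
  have hneg : ∀ t, 0 < t → s * t < δ → F t < 0 := by
    intro t ht hlt
    have hx : 0 < s * t := mul_pos hs0 ht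
    obtain ⟨p, q⟩ := hball (y := s * t) (by rw [Real.dist_eq, sub_zero, abs_of_pos hx]; exact hlt)
    have hK := K1_pos ht
    have hdK := dK1_nonpos ht
    simp only [hF]
    rw [J1_deriv, J1_eq]
    generalize s * t = x at *
    generalize PS cJ (x ^ 2 / 4) = h at *
    generalize PS (dcf cJ) (x ^ 2 / 4) = h1 at *
    have e1 : (lam - 1) * (x / 2 * h) * (t * deriv K1 t) ≤ 0 := by
      have : 0 ≤ (lam - 1) * (x / 2 * h) * t := by
        have : 0 < lam - 1 := by linarith
        positivity
      nlinarith
    have e2 : (K1 t * (x / 2)) * ((1 - lam) * h + 2 * (x ^ 2 / 4) * h1) < 0 :=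
      mul_neg_of_pos_of_neg (by positivity) q
    nlinarith
  have hT : 0 < 6 / s := by positivity
  have hpos : 0 < F (6 / s) := by
    obtain ⟨p, q⟩ := J1_six
    have hK := K1_pos hT
    have hdK := dK1_nonpos hT
    simp only [hF]
    rw [mul_div_cancel₀ 6 hs0.ne']
    have e1 : 0 ≤ (lam - 1) * J1 6 * (6 / s * deriv K1 (6 / s)) := by
      apply mul_nonneg_of_nonpos_of_nonpos
      · nlinarith
      · nlinarith
    have e2 : lam * K1 (6 / s) * J1 6 < 0 :=
      mul_neg_of_pos_of_neg (by positivity) p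
    have e3 : 0 < K1 (6 / s) * (6 * deriv J1 6) := by positivity
    linarith
  set d := min (δ / 2) 6 / s with hd
  have hd0 : 0 < d := by positivity
  have hsd : s * d = min (δ / 2) 6 := by rw [hd, mul_div_cancel₀ _ hs0.ne']
  have hdδ : s * d < δ := by rw [hsd]; exact (min_le_left _ _).trans_lt (by linarith)
  have hdT : d ≤ 6 / s := by rw [hd]; gcongr; exact min_le_right _ _
  have hsub : Set.Icc d (6 / s) ⊆ Set.Ioi 0 := fun t ht => hd0.trans_le ht.1
  have hcI := hcont.mono hsub
  obtain ⟨z, hz, hFz⟩ := intermediate_value_Icc hdT hcI ⟨(hneg d hd0 hdδ).le, hpos.le⟩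
  have hclosed : IsClosed (Set.Icc d (6 / s) ∩ F ⁻¹' {0}) :=
    hcI.preimage_isClosed_of_isClosed isClosed_Icc isClosed_singleton
  have hcomp : IsCompact (Set.Icc d (6 / s) ∩ F ⁻¹' {0}) :=
    isCompact_Icc.of_isClosed_subset hclosed Set.inter_subset_left
  obtain ⟨a, ⟨ha, haF⟩, hmin⟩ := hcomp.exists_isLeast ⟨z, hz, hFz⟩
  refine ⟨a, (hmem a).2 ⟨hsub ha, haF⟩, hsub ha, fun t ht => ?_⟩
  obtain ⟨ht0, htF⟩ := (hmem t).1 ht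
  by_contra! hlt
  have hdt : d ≤ t := by
    by_contra! hlt2
    have : s * t < δ := (mul_lt_mul_of_pos_left hlt2 hs0).trans hdδ
    have := hneg t ht0 this
    linarith
  have := hmin ⟨⟨hdt, hlt.le.trans ha.2⟩, htF⟩
  linarith
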